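/- Let γ_1 ≥ γ_2 ≥ ⋯ be a nonincreasing sequence of positive reals defining product weights γ_u = ∏_{j∈u} γ_j, and suppose sup_{d ≥ 1} max_{∅≠u⊆{1,…,d}} ∏_{j∈u} (j·γ_j) < ∞. Then the weighted star discrepancy of the Halton sequence achieves strong polynomial tractability with ε-exponent at most 2: for every β > 2 there exists a constant C > 0 such that for every dimension d ≥ 1 and every ε ∈ (0,1) there is an integer N ≤ C·ε^{−β} with D*_{N,γ}(H_{d,N}) ≤ ε. -/

import Mathlib

open Finset Real

noncomputable section

/-- Radical inverse function in base `b`: if `n = ∑ nᵢ bⁱ` then `radInv b n = ∑ nᵢ b^{-i-1}`. -/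
def radInv (b n : ℕ) : ℝ := ∑' i : ℕ, (((n / b ^ i) % b : ℕ) : ℝ) / (b : ℝ) ^ (i + 1)

/-- `n`-th point of the `d`-dimensional Halton sequence; coordinate `j` (0-based)
uses the `(j+1)`-st prime (`Nat.nth Nat.Prime 0 = 2`). -/
def halton (d n : ℕ) : Fin d → ℝ := fun j => radInv (Nat.nth Nat.Prime j) n

open scoped Classical in
/-- Star discrepancy of the point set `P` of `N` points with coordinates indexed by `ι`:
`D*_N(P) = sup_{α ∈ [0,1]^ι} |#{n : P n ∈ [0,α)}/N − ∏ᵢ αᵢ|`. -/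
def starDisc {ι : Type} [Fintype ι] (N : ℕ) (P : Fin N → ι → ℝ) : ℝ :=
  sSup {t : ℝ | ∃ α : ι → ℝ, (∀ i, 0 ≤ α i ∧ α i ≤ 1) ∧
    t = |((Finset.univ.filter fun n : Fin N => ∀ i, 0 ≤ P n i ∧ P n i < α i).card : ℝ) / N
          - ∏ i, α i|}

/-- Star discrepancy of the projection of the first `N` points of the `d`-dimensional
Halton sequence onto the coordinates in `u`. -/
def haltonProjStarDisc (d N : ℕ) (u : Finset (Fin d)) : ℝ :=
  starDisc N fun n (i : u) => halton d n i.1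

/-- Weighted star discrepancy, for product weights built from `γ : ℕ → ℝ` (1-based:
coordinate `j : Fin d` carries weight `γ (j+1)`), of the first `N` points of the
`d`-dimensional Halton sequence:
`max_{∅ ≠ u ⊆ [d]} (∏_{j ∈ u} γ_j) · D*_N(H_{d,N}(u))`. -/
def wHaltonStarDisc (γ : ℕ → ℝ) (d N : ℕ) : ℝ :=
  sSup {t : ℝ | ∃ u : Finset (Fin d), u.Nonempty ∧
    t = (∏ j ∈ u, γ (j.1 + 1)) * haltonProjStarDisc d N u}

/-- The integer whose base-`b` expansion consists of the `m` lowest digits of `n` in reverse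
order. -/
def digitRev (b n : ℕ) : ℕ → ℕ
  | 0 => 0
  | m + 1 => b * digitRev b n m + n / b ^ m % b

lemma digitRev_lt_pow {b : ℕ} (hb : 0 < b) (n m : ℕ) : digitRev b n m < b ^ m := by
  induction m with
  | zero => simp [digitRev]
  | succ m ih =>
    have h := Nat.mod_lt (n / b ^ m) hb
    have h' : b * (digitRev b n m + 1) ≤ b * b ^ m := Nat.mul_le_mul_left b ih
    rw [digitRev, pow_succ']
    linarith

lemma digitRev_add_one_le {b : ℕ} (hb : 0 < b) (n m k : ℕ) :
    digitRev b n (m + k) + 1 ≤ b ^ k * (digitRev b n m + 1) := by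
  induction k with
  | zero => simp
  | succ k ih =>
    have h := Nat.mod_lt (n / b ^ (m + k)) hb
    have h' := Nat.mul_le_mul_left b ih
    rw [← add_assoc, digitRev, pow_succ', mul_assoc]
    linarith

lemma sum_digits_eq_digitRev_div {b : ℕ} (hb : 0 < b) (n m : ℕ) :
    ∑ i ∈ range m, (((n / b ^ i) % b : ℕ) : ℝ) / (b : ℝ) ^ (i + 1) =
      digitRev b n m / (b : ℝ) ^ m := by
  have hb' : (b : ℝ) ≠ 0 := by positivity
  induction m with
  | zero => simp [digitRev]
  | succ m ih =>
    rw [sum_range_succ, ih, digitRev]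
    push_cast
    field_simp
    ring

lemma sum_digits_le {b : ℕ} (hb : 0 < b) (n m M : ℕ) :
    ∑ i ∈ range M, (((n / b ^ i) % b : ℕ) : ℝ) / (b : ℝ) ^ (i + 1) ≤
      (digitRev b n m + 1) / (b : ℝ) ^ m := by
  calc ∑ i ∈ range M, (((n / b ^ i) % b : ℕ) : ℝ) / (b : ℝ) ^ (i + 1)
      ≤ ∑ i ∈ range (m + M), (((n / b ^ i) % b : ℕ) : ℝ) / (b : ℝ) ^ (i + 1) :=
        sum_le_sum_of_subset_of_nonneg (range_subset_range.2 (by omega))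
          fun _ _ _ => by positivity
    _ = digitRev b n (m + M) / (b : ℝ) ^ (m + M) := sum_digits_eq_digitRev_div hb n _
    _ ≤ (digitRev b n m + 1) / (b : ℝ) ^ m := by
        have h : ((digitRev b n (m + M) : ℕ) : ℝ) + 1 ≤ (b : ℝ) ^ M * (digitRev b n m + 1) := by
          exact_mod_cast digitRev_add_one_le hb n m M
        rw [div_le_div_iff₀ (by positivity) (by positivity), pow_add]
        have hm : (0 : ℝ) ≤ (b : ℝ) ^ m := by positivity
        nlinarith

lemma radInv_le {b : ℕ} (hb : 0 < b) (n m : ℕ) :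
    radInv b n ≤ (digitRev b n m + 1) / (b : ℝ) ^ m :=
  Real.tsum_le_of_sum_range_le (fun _ => by positivity) (sum_digits_le hb n m)

lemma le_radInv {b : ℕ} (hb : 0 < b) (n m : ℕ) :
    digitRev b n m / (b : ℝ) ^ m ≤ radInv b n := by
  rw [← sum_digits_eq_digitRev_div hb]
  exact (summable_of_sum_range_le (fun _ => by positivity) (sum_digits_le hb n m)).sum_le_tsum _
    fun _ _ => by positivity

lemma radInv_nonneg (b n : ℕ) : 0 ≤ radInv b n :=
  tsum_nonneg fun _ => by positivity

lemma exists_mod_eq_iff_digitRev_eq {b : ℕ} (hb : 0 < b) (m : ℕ) {a : ℕ} (ha : a < b ^ m) :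
    ∃ r < b ^ m, ∀ n, digitRev b n m = a ↔ n % b ^ m = r := by
  induction m generalizing a with
  | zero => exact ⟨0, by simp, fun n => by simp_all [digitRev, Nat.mod_one]⟩
  | succ m ih =>
    obtain ⟨r, hr, h⟩ := ih (a := a / b) (by rwa [Nat.div_lt_iff_lt_mul hb, ← pow_succ])
    have hc := Nat.mod_lt a hb
    refine ⟨r + b ^ m * (a % b), ?_, fun n => ?_⟩
    · have : b ^ m * (a % b + 1) ≤ b ^ m * b := Nat.mul_le_mul_left _ hc
      rw [pow_succ]
      linarith
    have hd := Nat.mod_lt (n / b ^ m) hb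
    have hsplit : ∀ {c x x' y y' : ℕ}, x < c → x' < c →
        (x + c * y = x' + c * y' ↔ x = x' ∧ y = y') := by
      intro c x x' y y' hx hx'
      refine ⟨fun e => ?_, fun ⟨e, e'⟩ => by rw [e, e']⟩
      have e1 := congrArg (· % c) e
      have e2 := congrArg (· / c) e
      simp only [Nat.add_mul_mod_self_left, Nat.mod_eq_of_lt hx, Nat.mod_eq_of_lt hx'] at e1
      simp only [Nat.add_mul_div_left _ _ (Nat.zero_lt_of_lt hx), Nat.div_eq_of_lt hx,
        Nat.div_eq_of_lt hx', zero_add] at e2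
      exact ⟨e1, e2⟩
    rw [Nat.mod_pow_succ, hsplit (Nat.mod_lt _ (pow_pos hb m)) hr, ← h, digitRev, add_comm,
      and_comm]
    conv_lhs => rw [← Nat.mod_add_div a b]
    exact hsplit hd hc

open scoped Classical in
/-- The number of `n < N` with `n ≡ r (mod Q)` satisfying `S`. -/
def apCount (S : ℕ → Prop) (Q r N : ℕ) : ℕ := #{n ∈ range N | n ≡ r [MOD Q] ∧ S n}

/-- In every residue class to a modulus coprime to `q`, the set `S` has density `μ`, up to a
counting error of at most `c`. -/
def ApproxDensity (q : ℕ) (μ c : ℝ) (S : ℕ → Prop) : Prop :=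
  ∀ Q : ℕ, 0 < Q → Q.Coprime q → ∀ r N : ℕ, |(apCount S Q r N : ℝ) - N * μ / Q| ≤ c

lemma approxDensity_true : ApproxDensity 1 1 1 fun _ => True := by
  intro Q hQ _ r N
  have h : apCount (fun _ => True) Q r N = N / Q + if r % Q < N % Q then 1 else 0 := by
    rw [← Nat.count_modEq_card N hQ, Nat.count_eq_card_filter_range, apCount]
    congr 1
    ext
    simp
  have hN : (N : ℝ) = Q * (N / Q : ℕ) + (N % Q : ℕ) := by exact_mod_cast (Nat.div_add_mod N Q).symm
  have hlt : ((N % Q : ℕ) : ℝ) < Q := by exact_mod_cast Nat.mod_lt N hQ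
  have hQ' : (0 : ℝ) < Q := by exact_mod_cast hQ
  have key : (N : ℝ) * 1 / Q = (N / Q : ℕ) + (N % Q : ℕ) / (Q : ℝ) := by
    rw [mul_one, div_eq_iff hQ'.ne', add_mul, div_mul_cancel₀ _ hQ'.ne', mul_comm]
    exact hN
  have h0 : (0 : ℝ) ≤ (N % Q : ℕ) / (Q : ℝ) := by positivity
  have h1 : (N % Q : ℕ) / (Q : ℝ) < 1 := (div_lt_one hQ').2 hlt
  rw [h, key, abs_le]
  push_cast
  split_ifs <;> constructor <;> linarith

lemma ApproxDensity.nonneg {q : ℕ} {μ c : ℝ} {S : ℕ → Prop} (h : ApproxDensity q μ c S) :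
    0 ≤ c :=
  (abs_nonneg _).trans (h 1 one_pos (Nat.coprime_one_left q) 0 0)

lemma ApproxDensity.digitRev_eq {q : ℕ} {μ c : ℝ} {S : ℕ → Prop} (h : ApproxDensity q μ c S)
    {b : ℕ} (hb : 0 < b) (hbq : b.Coprime q) {m a : ℕ} (ha : a < b ^ m) :
    ApproxDensity (b * q) (μ / (b : ℝ) ^ m) c fun n => S n ∧ digitRev b n m = a := by
  intro Q hQ hcop r N
  obtain ⟨hQb, hQq⟩ := Nat.coprime_mul_iff_right.1 hcop
  obtain ⟨s, hs, hs'⟩ := exists_mod_eq_iff_digitRev_eq hb m ha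
  have hQbm : Q.Coprime (b ^ m) := hQb.pow_right m
  obtain ⟨k, hk, hk'⟩ := Nat.chineseRemainder hQbm r s
  have hcount : apCount (fun n => S n ∧ digitRev b n m = a) Q r N =
      apCount S (Q * b ^ m) k N := by
    unfold apCount
    congr 1
    ext n
    simp only [mem_filter, ← Nat.modEq_and_modEq_iff_modEq_mul hQbm, hs']
    have h1 : n ≡ r [MOD Q] ↔ n ≡ k [MOD Q] := ⟨fun e => e.trans hk.symm, fun e => e.trans hk⟩
    have h2 : n % b ^ m = s ↔ n ≡ k [MOD b ^ m] := by
      rw [← Nat.mod_eq_of_lt hs]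
      exact ⟨fun e => Nat.ModEq.trans e hk'.symm, fun e => Nat.ModEq.trans e hk'⟩
    rw [h1, h2]
    tauto
  have := h (Q * b ^ m) (by positivity) (Nat.Coprime.mul_left hQq (hbq.pow_left m)) k N
  rw [hcount]
  convert this using 3
  push_cast
  field_simp

lemma apCount_add {S S' T : ℕ → Prop} (hdisj : ∀ n, ¬ (S n ∧ S' n))
    (hT : ∀ n, T n ↔ S n ∨ S' n) (Q r N : ℕ) :
    apCount T Q r N = apCount S Q r N + apCount S' Q r N := by
  classical
  unfold apCount
  rw [← card_union_of_disjoint]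
  · congr 1
    ext n
    simp only [mem_filter, mem_union, hT]
    tauto
  · rw [disjoint_filter]
    exact fun n _ h h' => hdisj n ⟨h.2, h'.2⟩

lemma ApproxDensity.add {q : ℕ} {μ μ' c c' : ℝ} {S S' T : ℕ → Prop}
    (h : ApproxDensity q μ c S) (h' : ApproxDensity q μ' c' S')
    (hdisj : ∀ n, ¬ (S n ∧ S' n)) (hT : ∀ n, T n ↔ S n ∨ S' n) :
    ApproxDensity q (μ + μ') (c + c') T := by
  intro Q hQ hcop r N
  rw [apCount_add hdisj hT]
  push_cast
  calc _ = |((apCount S Q r N : ℝ) - N * μ / Q) + ((apCount S' Q r N : ℝ) - N * μ' / Q)| := by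
        congr 1
        ring
    _ ≤ _ := (abs_add_le _ _).trans (add_le_add (h Q hQ hcop r N) (h' Q hQ hcop r N))

lemma ApproxDensity.mono {q : ℕ} {μ c c' : ℝ} {S : ℕ → Prop} (h : ApproxDensity q μ c S)
    (hc : c ≤ c') : ApproxDensity q μ c' S :=
  fun Q hQ hcop r N => (h Q hQ hcop r N).trans hc

lemma ApproxDensity.digitRev_lt {q : ℕ} {μ c : ℝ} {S : ℕ → Prop} (h : ApproxDensity q μ c S)
    {b : ℕ} (hb : 0 < b) (hbq : b.Coprime q) (m : ℕ) {A : ℕ} (hA : A ≤ b ^ m) :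
    ApproxDensity (b * q) (μ * (A / (b : ℝ) ^ m)) ((m * b + 1) * c)
      fun n => S n ∧ digitRev b n m < A := by
  have hc := h.nonneg
  have hb' : (0 : ℝ) < b := by exact_mod_cast hb
  induction m generalizing A with
  | zero =>
    intro Q hQ hcop r N
    rw [pow_zero] at hA
    interval_cases A
    · simpa [apCount, digitRev] using hc
    · have e : (fun n => S n ∧ digitRev b n 0 < 1) = S := by
        ext n
        simp [digitRev]
      rw [e]
      simpa using h Q hQ (Nat.coprime_mul_iff_right.1 hcop).2 r N
  | succ m ih =>
    have step : ∀ k < b, ∀ B : ℕ, b * B + k ≤ b ^ (m + 1) →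
        ApproxDensity (b * q) (μ * ((b * B + k : ℕ) / (b : ℝ) ^ (m + 1))) ((m * b + 1 + k) * c)
          fun n => S n ∧ digitRev b n (m + 1) < b * B + k := by
      intro k
      induction k with
      | zero =>
        intro _ B hB
        have hB' : B ≤ b ^ m := by
          rw [pow_succ'] at hB
          exact Nat.le_of_mul_le_mul_left hB hb
        convert ih hB' using 1
        · push_cast
          field_simp
          ring
        · simp
        · ext n
          have := Nat.mod_lt (n / b ^ m) hb
          have e : digitRev b n (m + 1) < b * B + 0 ↔ digitRev b n m < B := by
            rw [digitRev]
            constructor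
            · intro e
              by_contra! e'
              have := Nat.mul_le_mul_left b e'
              omega
            · intro e
              have := Nat.mul_le_mul_left b (Nat.succ_le_of_lt e)
              rw [Nat.mul_succ] at this
              omega
          rw [e]
      | succ k ihk =>
        intro hk B hB
        have := (ihk (by omega) B (by omega)).add
          (h.digitRev_eq hb hbq (m := m + 1) (a := b * B + k) (by omega))
          (T := fun n => S n ∧ digitRev b n (m + 1) < b * B + (k + 1))
          (fun n => by omega) (fun n => by
            rw [← and_or_left, ← add_assoc, Nat.lt_succ_iff_lt_or_eq])
        convert this using 1
        · push_cast
          field_simp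
          ring
        · push_cast
          ring
    have hmod := Nat.mod_lt A hb
    have := step (A % b) hmod (A / b) (by rwa [Nat.div_add_mod])
    rw [Nat.div_add_mod] at this
    refine this.mono ?_
    have : ((A % b : ℕ) : ℝ) ≤ b := by exact_mod_cast hmod.le
    push_cast
    gcongr ?_ * c
    linarith

lemma approxDensity_forall_digitRev_lt {ι : Type*} (u : Finset ι) {b : ι → ℕ}
    (hb : ∀ i, 0 < b i) (hcop : Pairwise fun i j => (b i).Coprime (b j)) (m : ℕ) {A : ι → ℕ}
    (hA : ∀ i, A i ≤ b i ^ m) :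
    ApproxDensity (∏ i ∈ u, b i) (∏ i ∈ u, (A i / (b i : ℝ) ^ m)) (∏ i ∈ u, (m * b i + 1 : ℝ))
      fun n => ∀ i ∈ u, digitRev (b i) n m < A i := by
  classical
  induction u using Finset.induction_on with
  | empty => simpa using approxDensity_true
  | insert i u hi ih =>
    have hcop' : (b i).Coprime (∏ j ∈ u, b j) :=
      Nat.Coprime.prod_right fun j hj => hcop (by rintro rfl; exact hi hj)
    have := ih.digitRev_lt (hb i) hcop' m (hA i)
    rw [prod_insert hi, prod_insert hi, prod_insert hi, mul_comm ((A i : ℝ) / _)]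
    convert this using 2 with n
    simp [and_comm]

lemma abs_prod_sub_prod_le {ι : Type*} (u : Finset ι) {x y : ι → ℝ} {δ : ℝ}
    (hx : ∀ i, x i ∈ Set.Icc 0 1) (hy : ∀ i, y i ∈ Set.Icc 0 1) (hδ : ∀ i, |x i - y i| ≤ δ) :
    |∏ i ∈ u, x i - ∏ i ∈ u, y i| ≤ #u * δ := by
  classical
  induction u using Finset.induction_on with
  | empty => simp
  | insert i u hi ih =>
    have hP : |∏ j ∈ u, x j| ≤ 1 := by
      rw [abs_prod]
      exact prod_le_one (fun _ _ => abs_nonneg _) fun j _ => abs_le.2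
        ⟨by linarith [(hx j).1], (hx j).2⟩
    have hyi : |y i| ≤ 1 := abs_le.2 ⟨by linarith [(hy i).1], (hy i).2⟩
    rw [prod_insert hi, prod_insert hi, card_insert_of_notMem hi]
    calc |x i * ∏ j ∈ u, x j - y i * ∏ j ∈ u, y j|
        = |(x i - y i) * ∏ j ∈ u, x j + y i * (∏ j ∈ u, x j - ∏ j ∈ u, y j)| := by
          congr 1
          ring
      _ ≤ |x i - y i| * |∏ j ∈ u, x j| + |y i| * |∏ j ∈ u, x j - ∏ j ∈ u, y j| := by
          rw [← abs_mul, ← abs_mul]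
          exact abs_add_le _ _
      _ ≤ δ * 1 + 1 * (#u * δ) := by
          have h0 : 0 ≤ δ := (abs_nonneg _).trans (hδ i)
          gcongr
          exact hδ i
      _ = ((#u + 1 : ℕ) : ℝ) * δ := by
          push_cast
          ring

lemma abs_apCount_digitRev_sub_le {ι : Type} [Fintype ι] {b : ι → ℕ} (hb : ∀ i, 2 ≤ b i)
    (hcop : Pairwise fun i j => (b i).Coprime (b j)) {N m : ℕ} (hm : N ≤ 2 ^ m)
    {α : ι → ℝ} (hα : ∀ i, α i ∈ Set.Icc 0 1) {A : ι → ℕ} (hA : ∀ i, A i ≤ b i ^ m)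
    (hAα : ∀ i, |(A i : ℝ) - α i * (b i : ℝ) ^ m| ≤ 1) :
    |(apCount (fun n => ∀ i, digitRev (b i) n m < A i) 1 0 N : ℝ) - N * ∏ i, α i| ≤
      2 * ∏ i, ((b i : ℝ) * (m + 1)) := by
  have hb0 : ∀ i, 0 < b i := fun i => by linarith [hb i]
  have hbm : ∀ i, (0 : ℝ) < (b i : ℝ) ^ m := fun i => by
    have := hb0 i
    positivity
  have h2m : ∀ i, (2 : ℝ) ^ m ≤ (b i : ℝ) ^ m := fun i => by
    gcongr
    exact_mod_cast hb i
  have hcount := approxDensity_forall_digitRev_lt univ hb0 hcop m hA 1 one_pos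
    (Nat.coprime_one_left _) 0 N
  simp only [mem_univ, true_imp_iff, Nat.cast_one, div_one] at hcount
  have hvol : |∏ i, ((A i : ℝ) / (b i : ℝ) ^ m) - ∏ i, α i| ≤
      #(univ : Finset ι) * (1 / (2 : ℝ) ^ m) := by
    refine abs_prod_sub_prod_le univ (fun i => ⟨by positivity, ?_⟩) hα fun i => ?_
    · rw [div_le_one (hbm i)]
      exact_mod_cast hA i
    · have : (A i : ℝ) / (b i : ℝ) ^ m - α i = (A i - α i * (b i : ℝ) ^ m) / (b i : ℝ) ^ m := by
        have := (hbm i).ne'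
        field_simp
      rw [this, abs_div, abs_of_pos (hbm i)]
      exact div_le_div₀ zero_le_one (hAα i) (by positivity) (h2m i)
  have hNvol : |N * ∏ i, ((A i : ℝ) / (b i : ℝ) ^ m) - N * ∏ i, α i| ≤
      #(univ : Finset ι) := by
    have hN2 : (N : ℝ) ≤ 2 ^ m := by exact_mod_cast hm
    rw [← mul_sub, abs_mul, Nat.abs_cast]
    calc _ ≤ (2 : ℝ) ^ m * (#(univ : Finset ι) * (1 / (2 : ℝ) ^ m)) := by gcongr
      _ = _ := by field_simp
  have hcard : (#(univ : Finset ι) : ℝ) ≤ ∏ i, ((b i : ℝ) * (m + 1)) := by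
    calc (#(univ : Finset ι) : ℝ) ≤ (2 : ℝ) ^ #(univ : Finset ι) := by
          exact_mod_cast Nat.lt_two_pow_self.le
      _ = ∏ _i : ι, (2 : ℝ) := by simp
      _ ≤ _ := by
          refine prod_le_prod (fun _ _ => by positivity) fun i _ => ?_
          have : (2 : ℝ) ≤ b i := by exact_mod_cast hb i
          have : (0 : ℝ) ≤ m := by positivity
          nlinarith
  have hprod : ∏ i, (m * b i + 1 : ℝ) ≤ ∏ i, ((b i : ℝ) * (m + 1)) := by
    refine prod_le_prod (fun _ _ => by positivity) fun i _ => ?_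
    have : (2 : ℝ) ≤ b i := by exact_mod_cast hb i
    linarith
  calc _ ≤ _ := abs_sub_le _ (N * ∏ i, ((A i : ℝ) / (b i : ℝ) ^ m)) _
    _ ≤ _ := by linarith

/-- A form of the classical discrepancy bound for the Halton sequence in pairwise coprime bases. -/
lemma starDisc_radInv_le {ι : Type} [Fintype ι] {b : ι → ℕ} (hb : ∀ i, 2 ≤ b i)
    (hcop : Pairwise fun i j => (b i).Coprime (b j)) {N : ℕ} (hN : 0 < N) :
    starDisc N (fun (n : Fin N) i => radInv (b i) n) ≤
      2 / N * ∏ i, ((b i : ℝ) * (Nat.clog 2 N + 1)) := by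
  classical
  have hb0 : ∀ i, 0 < b i := fun i => by linarith [hb i]
  refine csSup_le ⟨_, 0, by simp, rfl⟩ ?_
  rintro _ ⟨α, hα, rfl⟩
  set m := Nat.clog 2 N
  have hNm : N ≤ 2 ^ m := Nat.le_pow_clog one_lt_two N
  have hbm : ∀ i, (0 : ℝ) < (b i : ℝ) ^ m := fun i => by
    have := hb0 i
    positivity
  set A : ι → ℕ := fun i => ⌈α i * (b i : ℝ) ^ m⌉₊
  have hx0 : ∀ i, 0 ≤ α i * (b i : ℝ) ^ m := fun i => mul_nonneg (hα i).1 (hbm i).le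
  have hA1 : ∀ i, α i * (b i : ℝ) ^ m ≤ A i := fun i => Nat.le_ceil _
  have hA2 : ∀ i, (A i : ℝ) < α i * (b i : ℝ) ^ m + 1 := fun i => Nat.ceil_lt_add_one (hx0 i)
  have hAb : ∀ i, A i ≤ b i ^ m := fun i => Nat.ceil_le.2 <| by
    push_cast
    exact mul_le_of_le_one_left (hbm i).le (hα i).2
  have hcard : #{n : Fin N | ∀ i, 0 ≤ radInv (b i) n ∧ radInv (b i) n < α i} =
      apCount (fun n => ∀ i, radInv (b i) n < α i) 1 0 N := by
    simp only [radInv_nonneg, true_and, apCount, Nat.modEq_one, card_filter]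
    exact Fin.sum_univ_eq_sum_range (fun n => if ∀ i, radInv (b i) n < α i then 1 else 0) N
  have hmono : ∀ {S T : ℕ → Prop}, (∀ n, S n → T n) →
      (apCount S 1 0 N : ℝ) ≤ apCount T 1 0 N := fun h => by
    unfold apCount
    gcongr with n
    exact h n
  have hupper : (apCount (fun n => ∀ i, radInv (b i) n < α i) 1 0 N : ℝ) ≤
      apCount (fun n => ∀ i, digitRev (b i) n m < A i) 1 0 N := by
    refine hmono fun n h i => Nat.lt_ceil.2 ?_
    rw [← div_lt_iff₀ (hbm i)]
    exact (le_radInv (hb0 i) n m).trans_lt (h i)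
  have hlower : (apCount (fun n => ∀ i, digitRev (b i) n m < A i - 1) 1 0 N : ℝ) ≤
      apCount (fun n => ∀ i, radInv (b i) n < α i) 1 0 N := by
    refine hmono fun n h i => (radInv_le (hb0 i) n m).trans_lt ?_
    have : digitRev (b i) n m + 1 < A i := by have := h i; omega
    rw [div_lt_iff₀ (hbm i)]
    exact_mod_cast Nat.lt_ceil.1 this
  have h1 := abs_le.1 <| abs_apCount_digitRev_sub_le hb hcop hNm hα hAb fun i =>
    abs_le.2 ⟨by linarith [hA1 i], by linarith [hA2 i]⟩
  have h2 := abs_le.1 <| abs_apCount_digitRev_sub_le hb hcop hNm hα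
    (A := fun i => A i - 1) (fun i => (Nat.sub_le _ _).trans (hAb i)) fun i => by
      rcases Nat.eq_zero_or_pos (A i) with h0 | h0
      · have := hA1 i
        have := hx0 i
        simp only [h0, Nat.cast_zero] at *
        exact abs_le.2 ⟨by push_cast; linarith, by push_cast; linarith⟩
      · rw [Nat.cast_sub h0]
        exact abs_le.2 ⟨by push_cast; linarith [hA1 i], by push_cast; linarith [hA2 i]⟩
  have hN' : (0 : ℝ) < N := by exact_mod_cast hN
  rw [hcard, div_sub' hN'.ne', abs_div, abs_of_pos hN', div_mul_eq_mul_div,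
    div_le_div_iff_of_pos_right hN', abs_le]
  exact ⟨by linarith, by linarith⟩

lemma starDisc_le_one {ι : Type} [Fintype ι] (N : ℕ) (P : Fin N → ι → ℝ) : starDisc N P ≤ 1 := by
  classical
  refine csSup_le ⟨_, 0, by simp, rfl⟩ ?_
  rintro _ ⟨α, hα, rfl⟩
  have h0 : 0 ≤ ∏ i, α i := prod_nonneg fun i _ => (hα i).1
  have h1 : ∏ i, α i ≤ 1 := prod_le_one (fun i _ => (hα i).1) fun i _ => (hα i).2
  have hcard : #{n : Fin N | ∀ i, 0 ≤ P n i ∧ P n i < α i} ≤ N :=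
    (card_filter_le _ _).trans_eq (by simp)
  have h2 : (#{n : Fin N | ∀ i, 0 ≤ P n i ∧ P n i < α i} : ℝ) / N ≤ 1 :=
    div_le_one_of_le₀ (by exact_mod_cast hcard) (by positivity)
  have h3 : (0 : ℝ) ≤ (#{n : Fin N | ∀ i, 0 ≤ P n i ∧ P n i < α i} : ℝ) / N := by positivity
  rw [abs_le]
  exact ⟨by linarith, by linarith⟩

lemma haltonProjStarDisc_le (d : ℕ) {N : ℕ} (hN : 0 < N) (u : Finset (Fin d)) :
    haltonProjStarDisc d N u ≤
      2 / N * ∏ j ∈ u, ((Nat.nth Nat.Prime j : ℝ) * (Nat.clog 2 N + 1)) := by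
  have hp : ∀ k, (Nat.nth Nat.Prime k).Prime := Nat.prime_nth_prime
  have := starDisc_radInv_le (b := fun i : u => Nat.nth Nat.Prime i.1) (fun i => (hp _).two_le)
    (fun i j hij => (Nat.coprime_primes (hp _) (hp _)).2 fun e =>
      hij (Subtype.ext (Fin.ext (Nat.nth_injective Nat.infinite_setOfPred_prime e)))) hN
  rwa [prod_coe_sort u fun j : Fin d => (Nat.nth Nat.Prime j : ℝ) * (Nat.clog 2 N + 1)] at this

lemma exists_nth_prime_le {δ : ℝ} (hδ : 0 < δ) :
    ∃ C : ℝ, 0 < C ∧ ∀ k : ℕ, (Nat.nth Nat.Prime k : ℝ) ≤ C * ((k : ℝ) + 1) ^ (1 + δ) := by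
  set η := δ / (1 + δ) with hη
  have hη0 : 0 < η := by positivity
  have hl2 : 0 < log 2 := log_pos one_lt_two
  refine ⟨(3 / (η * log 2)) ^ (1 + δ), by positivity, fun k => ?_⟩
  set p := Nat.nth Nat.Prime k
  have hpp : p.Prime := Nat.prime_nth_prime k
  have hp2 : (2 : ℝ) ≤ p := by exact_mod_cast hpp.two_le
  have hp0 : (0 : ℝ) < p := by linarith
  have hlp : 0 < log p := log_pos (by linarith)
  have hpi : Nat.primeCounting p = k + 1 := by
    rw [Nat.primeCounting, Nat.primeCounting', Nat.count_succ, if_pos hpp]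
    exact congrArg (· + 1) (Nat.primeCounting'_nth_eq k)
  have h1 : p * log 2 - log (p + 1) ≤ (k + 1) * log p := by
    have := Chebyshev.pi_ge p
    rw [hpi, div_le_iff₀ hlp] at this
    exact_mod_cast this
  have h2 : log (p + 1) ≤ 2 * log p := by
    rw [← log_rpow hp0]
    refine log_le_log (by linarith) ?_
    norm_num
    nlinarith
  have h3 : log p ≤ (p : ℝ) ^ η / η := log_le_rpow_div hp0.le hη0
  have hk : (0 : ℝ) ≤ k := by positivity
  have h4 : p * log 2 ≤ 3 * (k + 1) * ((p : ℝ) ^ η / η) := by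
    calc p * log 2 ≤ 3 * (k + 1) * log p := by nlinarith
      _ ≤ _ := by gcongr
  have hsplit : (p : ℝ) = (p : ℝ) ^ (1 / (1 + δ)) * (p : ℝ) ^ η := by
    rw [← rpow_add hp0, hη, ← add_div, div_self (by positivity), rpow_one]
  have hpη : (0 : ℝ) < (p : ℝ) ^ η := by positivity
  have h5 : (p : ℝ) ^ (1 / (1 + δ)) ≤ 3 / (η * log 2) * (k + 1) := by
    rw [div_mul_eq_mul_div, le_div_iff₀ (by positivity)]
    have h6 : (p : ℝ) * log 2 * η ≤ 3 * (k + 1) * (p : ℝ) ^ η := by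
      rw [← mul_div_assoc, le_div_iff₀ hη0] at h4
      exact h4
    refine le_of_mul_le_mul_right ?_ hpη
    calc _ = ((p : ℝ) ^ (1 / (1 + δ)) * (p : ℝ) ^ η) * log 2 * η := by ring
      _ ≤ _ := by rw [← hsplit]; exact h6
  calc (p : ℝ) = ((p : ℝ) ^ (1 / (1 + δ))) ^ (1 + δ) := by
        rw [← rpow_mul hp0.le, one_div_mul_cancel (by positivity), rpow_one]
    _ ≤ (3 / (η * log 2) * (k + 1)) ^ (1 + δ) := by gcongr
    _ = _ := mul_rpow (by positivity) (by positivity)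

lemma exists_rpow_le_mul_add {θ η : ℝ} (hθ0 : 0 ≤ θ) (hθ1 : θ < 1) (hη : 0 < η) :
    ∃ T : ℝ, 0 ≤ T ∧ ∀ y : ℝ, 0 ≤ y → y ^ θ ≤ η * y + T := by
  set Y : ℝ := η ^ (-(1 / (1 - θ))) with hY
  have hY0 : 0 < Y := by positivity
  refine ⟨Y ^ θ, by positivity, fun y hy => ?_⟩
  rcases le_total y Y with h | h
  · have : y ^ θ ≤ Y ^ θ := rpow_le_rpow hy h hθ0
    nlinarith
  · have hy0 : 0 < y := hY0.trans_le h
    have h1 : y ^ (θ - 1) ≤ η := by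
      calc y ^ (θ - 1) ≤ Y ^ (θ - 1) := rpow_le_rpow_of_nonpos hY0 h (by linarith)
        _ = η := by
          rw [hY, ← rpow_mul hη.le]
          have : -(1 / (1 - θ)) * (θ - 1) = 1 := by
            have : 1 - θ ≠ 0 := by linarith
            field_simp
            ring
          rw [this, rpow_one]
    have h2 : y ^ θ = y ^ (θ - 1) * y := by
      rw [← rpow_add_one hy0.ne', sub_add_cancel]
    have : 0 < Y ^ θ := by positivity
    rw [h2]
    nlinarith

lemma pow_le_factorial_rpow_mul_exp {K a : ℝ} (hK : 0 ≤ K) (ha : 0 < a) (s : ℕ) :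
    K ^ s ≤ (s.factorial : ℝ) ^ a * exp (a * K ^ (1 / a)) := by
  have h := pow_div_factorial_le_exp (x := K ^ (1 / a)) (by positivity) s
  rw [div_le_iff₀ (by positivity)] at h
  calc K ^ s = ((K ^ (1 / a)) ^ s) ^ a := by
        rw [← rpow_natCast (K ^ (1 / a)), ← rpow_mul (by positivity), ← rpow_mul hK,
          mul_comm (s : ℝ), ← mul_assoc, one_div_mul_cancel ha.ne', one_mul, rpow_natCast]
    _ ≤ (exp (K ^ (1 / a)) * s.factorial) ^ a := by gcongr
    _ = _ := by
      rw [mul_rpow (by positivity) (by positivity), ← exp_mul, mul_comm, mul_comm a]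

lemma factorial_card_le_prod {d : ℕ} (u : Finset (Fin d)) :
    (#u).factorial ≤ ∏ j ∈ u, (j.1 + 1) := by
  induction u using Finset.induction_on_max with
  | empty => simp
  | insert a u h ih =>
    have ha : a ∉ u := fun h' => (h a h').false
    have hcard : #u ≤ a := by
      have : u ⊆ Iio a := fun x hx => mem_Iio.2 (h x hx)
      simpa using card_le_card this
    rw [card_insert_of_notMem ha, prod_insert ha, Nat.factorial_succ]
    gcongr

lemma clog_two_le (N : ℕ) : (Nat.clog 2 N : ℝ) ≤ log N / log 2 + 1 := by
  rcases le_or_gt N 1 with h | h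
  · rw [Nat.clog_of_right_le_one h]
    have : 0 ≤ log N / log 2 := by positivity
    push_cast
    linarith
  · have h1 := Nat.pow_pred_clog_lt_self one_lt_two h
    have hpos := Nat.clog_pos one_lt_two h
    have h2 : (2 : ℝ) ^ (Nat.clog 2 N - 1) ≤ N := by exact_mod_cast h1.le
    have h3 := log_le_log (by positivity) h2
    rw [log_pow, Nat.cast_sub hpos, Nat.cast_one] at h3
    rw [← sub_le_iff_le_add, le_div_iff₀ (log_pos one_lt_two)]
    exact h3

lemma exists_exp_rpow_clog_le {a C η : ℝ} (ha : 1 < a) (hC : 0 < C) (hη : 0 < η) :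
    ∃ T : ℝ, 0 < T ∧ ∀ N : ℕ, 0 < N →
      exp (a * (C * (Nat.clog 2 N + 1)) ^ (1 / a)) ≤ T * (N : ℝ) ^ η := by
  have hl2 : 0 < log 2 := log_pos one_lt_two
  have ha0 : 0 < a := by linarith
  obtain ⟨T, hT, h⟩ := exists_rpow_le_mul_add (θ := 1 / a) (η := η * log 2 / (a * C))
    (by positivity) ((div_lt_one ha0).2 ha) (by positivity)
  refine ⟨exp (a * T + 2 * η * log 2), exp_pos _, fun N hN => ?_⟩
  have hN' : (0 : ℝ) < N := by exact_mod_cast hN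
  rw [rpow_def_of_pos hN', ← exp_add, exp_le_exp]
  have hL : (Nat.clog 2 N + 1 : ℝ) * log 2 ≤ log N + 2 * log 2 := by
    have := clog_two_le N
    rw [← sub_le_iff_le_add, le_div_iff₀ hl2] at this
    linarith
  calc a * (C * (Nat.clog 2 N + 1 : ℝ)) ^ (1 / a)
      ≤ a * (η * log 2 / (a * C) * (C * (Nat.clog 2 N + 1)) + T) := by
        gcongr
        exact h _ (by positivity)
    _ = η * ((Nat.clog 2 N + 1) * log 2) + a * T := by
        field_simp
    _ ≤ η * (log N + 2 * log 2) + a * T := by gcongr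
    _ = _ := by ring

lemma exists_haltonProjStarDisc_le {δ : ℝ} (hδ : 0 < δ) :
    ∃ T : ℝ, 0 < T ∧ ∀ d N : ℕ, 0 < N → ∀ u : Finset (Fin d),
      haltonProjStarDisc d N u ≤
        T * (N : ℝ) ^ (δ - 1) * (∏ j ∈ u, ((j.1 + 1 : ℕ) : ℝ)) ^ (2 + 2 * δ) := by
  obtain ⟨C, hC, hp⟩ := exists_nth_prime_le hδ
  obtain ⟨T, hT, hexp⟩ := exists_exp_rpow_clog_le (a := 1 + δ) (by linarith) hC hδ
  refine ⟨2 * T, by positivity, fun d N hN u => ?_⟩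
  have hN' : (0 : ℝ) < N := by exact_mod_cast hN
  set L : ℝ := Nat.clog 2 N + 1
  have hL0 : 0 < L := by positivity
  set Q : ℝ := ∏ j ∈ u, ((j.1 + 1 : ℕ) : ℝ) with hQ
  have hQ0 : 0 < Q := prod_pos fun _ _ => by positivity
  have hfac : ((#u).factorial : ℝ) ≤ Q := by
    rw [hQ, ← Nat.cast_prod]
    exact_mod_cast factorial_card_le_prod u
  calc haltonProjStarDisc d N u
      ≤ 2 / N * ∏ j ∈ u, ((Nat.nth Nat.Prime j : ℝ) * L) := haltonProjStarDisc_le d hN u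
    _ ≤ 2 / N * ∏ j ∈ u, (((j.1 + 1 : ℕ) : ℝ) ^ (1 + δ) * (C * L)) := by
        refine mul_le_mul_of_nonneg_left
          (prod_le_prod (fun _ _ => by positivity) fun j _ => ?_) (by positivity)
        calc (Nat.nth Nat.Prime j : ℝ) * L ≤ C * ((j.1 : ℝ) + 1) ^ (1 + δ) * L := by
              gcongr
              exact hp j
          _ = _ := by
              push_cast
              ring
    _ = 2 / N * (Q ^ (1 + δ) * (C * L) ^ #u) := by
        rw [prod_mul_distrib, prod_const, finsetProd_rpow _ _ fun _ _ => by positivity]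
    _ ≤ 2 / N * (Q ^ (1 + δ) * (Q ^ (1 + δ) * (T * (N : ℝ) ^ δ))) := by
        have := pow_le_factorial_rpow_mul_exp (K := C * L) (a := 1 + δ) (by positivity)
          (by positivity) #u
        grw [this, hfac, hexp N hN]
    _ = 2 * T * ((N : ℝ) ^ δ / N) * (Q ^ (1 + δ) * Q ^ (1 + δ)) := by ring
    _ = _ := by
        rw [← rpow_sub_one hN'.ne', ← rpow_add hQ0]
        ring_nf

/-- If `sup_{d≥1} max_{∅≠u⊆[d]} ∏_{j∈u} (j·γ_j) < ∞`, then the weighted star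
discrepancy of the Halton sequence achieves strong polynomial tractability with
ε-exponent at most 2. -/
theorem halton_weighted_star_disc_SPT_exponent_two
    (γ : ℕ → ℝ) (hpos : ∀ j : ℕ, 1 ≤ j → 0 < γ j)
    (hmono : ∀ j : ℕ, 1 ≤ j → γ (j + 1) ≤ γ j)
    (hbdd : ∃ B : ℝ, ∀ d : ℕ, 1 ≤ d → ∀ u : Finset (Fin d), u.Nonempty →
      (∏ j ∈ u, ((j.1 + 1 : ℕ) : ℝ) * γ (j.1 + 1)) ≤ B) :
    ∀ β : ℝ, 2 < β → ∃ C : ℝ, 0 < C ∧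
      ∀ d : ℕ, 1 ≤ d → ∀ ε : ℝ, 0 < ε → ε < 1 →
        ∃ N : ℕ, 1 ≤ N ∧ (N : ℝ) ≤ C * ε ^ (-β) ∧ wHaltonStarDisc γ d N ≤ ε := by
  obtain ⟨B, hB⟩ := hbdd
  intro β hβ
  have hB0 : 0 < B := by
    refine lt_of_lt_of_le ?_ (hB 1 le_rfl {0} (singleton_nonempty _))
    simpa using hpos 1 le_rfl
  set δ : ℝ := (β - 2) / (β + 2) with hδdef
  have hδ : 0 < δ := div_pos (by linarith) (by linarith)
  have hδ1 : δ < 1 := (div_lt_one (by linarith)).2 (by linarith)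
  have hδβ : (2 + 2 * δ) / (1 - δ) = β := by
    rw [div_eq_iff (by linarith), hδdef]
    field_simp
    ring
  obtain ⟨T, hT, hdisc⟩ := exists_haltonProjStarDisc_le hδ
  set D : ℝ := (T * B ^ (2 + 2 * δ)) ^ (1 / (1 - δ)) with hD
  have hD0 : 0 < D := by positivity
  refine ⟨D + 1, by positivity, fun d hd ε hε hε1 => ?_⟩
  have hεβ : 1 ≤ ε ^ (-β) := one_le_rpow_of_pos_of_le_one_of_nonpos hε hε1.le (by linarith)
  set N : ℕ := ⌈D * ε ^ (-β)⌉₊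
  have hN : 0 < N := Nat.ceil_pos.2 (by positivity)
  have hN' : (0 : ℝ) < N := by exact_mod_cast hN
  refine ⟨N, hN, ?_, ?_⟩
  · have := Nat.ceil_lt_add_one (a := D * ε ^ (-β)) (by positivity)
    linarith
  have hNpow : T * B ^ (2 + 2 * δ) * ε ^ (-(2 + 2 * δ)) ≤ (N : ℝ) ^ (1 - δ) := by
    calc T * B ^ (2 + 2 * δ) * ε ^ (-(2 + 2 * δ)) = (D * ε ^ (-β)) ^ (1 - δ) := by
          have h1 : 1 - δ ≠ 0 := by linarith
          rw [mul_rpow (by positivity) (by positivity), hD, ← rpow_mul (by positivity),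
            one_div_mul_cancel h1, rpow_one, ← rpow_mul hε.le, ← hδβ, neg_mul,
            div_mul_cancel₀ _ h1]
      _ ≤ _ := rpow_le_rpow (by positivity) (Nat.le_ceil _) (by linarith)
  refine csSup_le ⟨_, {⟨0, hd⟩}, singleton_nonempty _, rfl⟩ ?_
  rintro _ ⟨u, hu, rfl⟩
  set Q : ℝ := ∏ j ∈ u, ((j.1 + 1 : ℕ) : ℝ) with hQ
  have hQ0 : 0 < Q := prod_pos fun _ _ => by positivity
  have hγ0 : 0 < ∏ j ∈ u, γ (j.1 + 1) := prod_pos fun j _ => hpos _ (by omega)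
  have hγ : ∏ j ∈ u, γ (j.1 + 1) ≤ B / Q := by
    rw [le_div_iff₀ hQ0, mul_comm, hQ, ← prod_mul_distrib]
    exact hB d hd u hu
  rcases le_total (B / ε) Q with h | h
  · calc _ ≤ (∏ j ∈ u, γ (j.1 + 1)) * 1 :=
          mul_le_mul_of_nonneg_left (starDisc_le_one _ _) hγ0.le
      _ ≤ B / Q := by rwa [mul_one]
      _ ≤ ε := by
          rw [div_le_iff₀ hε] at h
          rw [div_le_iff₀ hQ0]
          linarith
  · calc _ ≤ (∏ j ∈ u, γ (j.1 + 1)) * (T * (N : ℝ) ^ (δ - 1) * Q ^ (2 + 2 * δ)) :=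
          mul_le_mul_of_nonneg_left (hdisc d N hN u) hγ0.le
      _ ≤ B / Q * (T * (N : ℝ) ^ (δ - 1) * Q ^ (2 + 2 * δ)) := by gcongr
      _ = B * T * (N : ℝ) ^ (δ - 1) * Q ^ (1 + 2 * δ) := by
          have : Q ^ (2 + 2 * δ) = Q ^ (1 + 2 * δ) * Q := by
            rw [← rpow_add_one hQ0.ne']
            ring_nf
          rw [this]
          field_simp
      _ ≤ B * T * (N : ℝ) ^ (δ - 1) * (B / ε) ^ (1 + 2 * δ) := by gcongr
      _ = ε * ((T * B ^ (2 + 2 * δ) * ε ^ (-(2 + 2 * δ))) / (N : ℝ) ^ (1 - δ)) := by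
          have h1 : (N : ℝ) ^ (δ - 1) = ((N : ℝ) ^ (1 - δ))⁻¹ := by
            rw [← rpow_neg hN'.le, neg_sub]
          have h2 : B ^ (2 + 2 * δ) = B ^ (1 + 2 * δ) * B := by
            rw [← rpow_add_one hB0.ne']
            ring_nf
          have h3 : ε ^ (2 + 2 * δ) = ε ^ (1 + 2 * δ) * ε := by
            rw [← rpow_add_one hε.ne']
            ring_nf
          rw [div_rpow hB0.le hε.le, h1, rpow_neg hε.le, h2, h3]
          field_simp
      _ ≤ ε * 1 := by
          gcongr
          exact div_le_one_of_le₀ hNpow (by positivity)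
      _ = ε := mul_one ε
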